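/- (Optimal Path Measure satisfies the forward equation of the optimal generator.) Let 𝒳 be a finite type, Q⁰ : ℝ → 𝒳 → 𝒳 → ℝ, Z ≠ 0 a real constant, and p⁰, V : ℝ → 𝒳 → ℝ with t ↦ p⁰_t(x) and t ↦ V_t(x) differentiable for every x ∈ 𝒳. Assume: (i) for all t, x, ∂_t p⁰_t(x) = Σ_{y ≠ x} ( Q⁰_t(y, x)·p⁰_t(y) − Q⁰_t(x, y)·p⁰_t(x) ); (ii) for all t, x, ∂_t e^{V_t(x)} = Σ_{y ≠ x} Q⁰_t(x, y)·( e^{V_t(x)} − e^{V_t(y)} ). Define Q*_t(x, y) = Q⁰_t(x, y)·e^{V_t(y) − V_t(x)} for x ≠ y and h_t(x) = (1/Z)·p⁰_t(x)·e^{V_t(x)}. Then for all t ∈ ℝ and x ∈ 𝒳, ∂_t h_t(x) = Σ_{y ≠ x} ( Q*_t(y, x)·h_t(y) − Q*_t(x, y)·h_t(x) ). -/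

import Mathlib

/-- The optimal controlled generator `Q*_t(x, y) = Q⁰_t(x, y)·e^{V_t(y) − V_t(x)}`. -/
noncomputable def Qstar {𝒳 : Type*} (Q0 : ℝ → 𝒳 → 𝒳 → ℝ) (V : ℝ → 𝒳 → ℝ)
    (t : ℝ) (x y : 𝒳) : ℝ :=
  Q0 t x y * Real.exp (V t y - V t x)

/-- The reward-tilted marginal `h_t(x) = Z⁻¹·p⁰_t(x)·e^{V_t(x)}`. -/
noncomputable def tiltedMarginal {𝒳 : Type*} (Z : ℝ) (p0 V : ℝ → 𝒳 → ℝ)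
    (t : ℝ) (x : 𝒳) : ℝ :=
  (1 / Z) * p0 t x * Real.exp (V t x)

/-- **Optimal path measure satisfies the forward equation of the optimal
generator.** If `p⁰` solves the Kolmogorov forward equation for `Q⁰` and `V`
solves the exponentiated HJB equation, then the reward-tilted marginal
`h_t(x) = Z⁻¹ p⁰_t(x) e^{V_t(x)}` solves the Kolmogorov forward equation for
the optimal generator `Q*_t(x, y) = Q⁰_t(x, y)·e^{V_t(y) − V_t(x)}`. -/
theorem tilted_marginal_forward_equation {𝒳 : Type*} [Fintype 𝒳] [DecidableEq 𝒳]
    (Q0 : ℝ → 𝒳 → 𝒳 → ℝ) (Z : ℝ) (hZ : Z ≠ 0) (p0 V : ℝ → 𝒳 → ℝ)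
    (hp0diff : ∀ (x : 𝒳) (t : ℝ), DifferentiableAt ℝ (fun s => p0 s x) t)
    (hVdiff : ∀ (x : 𝒳) (t : ℝ), DifferentiableAt ℝ (fun s => V s x) t)
    (hKFE : ∀ (t : ℝ) (x : 𝒳),
      deriv (fun s => p0 s x) t
        = ∑ y ∈ ({x}ᶜ : Finset 𝒳), (Q0 t y x * p0 t y - Q0 t x y * p0 t x))
    (hHJB : ∀ (t : ℝ) (x : 𝒳),
      deriv (fun s => Real.exp (V s x)) t
        = ∑ y ∈ ({x}ᶜ : Finset 𝒳), Q0 t x y * (Real.exp (V t x) - Real.exp (V t y))) :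
    ∀ (t : ℝ) (x : 𝒳),
      deriv (fun s => tiltedMarginal Z p0 V s x) t
        = ∑ y ∈ ({x}ᶜ : Finset 𝒳),
            (Qstar Q0 V t y x * tiltedMarginal Z p0 V t y
              - Qstar Q0 V t x y * tiltedMarginal Z p0 V t x) := by
  intro t x
  have hp := (hp0diff x t).hasDerivAt
  have he := ((hVdiff x t).exp).hasDerivAt
  rw [hKFE t x] at hp
  rw [hHJB t x] at he
  have hd := (hp.const_mul (1 / Z)).mul he
  have hd' : HasDerivAt (fun s => tiltedMarginal Z p0 V s x) _ t := hd
  rw [hd'.deriv, Finset.mul_sum, Finset.sum_mul, Finset.mul_sum, ← Finset.sum_add_distrib]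
  refine Finset.sum_congr rfl fun y _ => ?_
  have hx := (Real.exp_pos (V t x)).ne'
  have hy := (Real.exp_pos (V t y)).ne'
  simp only [Qstar, tiltedMarginal, Real.exp_sub]
  field_simp
  ring
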